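/- Let $\omega$ be a smooth function on $\Omega_* = \{z \in \mathbb{R}^2 : |z| > R_*\}$, continuous up to the boundary, satisfying the strong maximum principle, with $\omega(z) \to 0$ as $|z| \to \infty$, and suppose every nonzero level-set component of $\omega$ in $\Omega_*$ meets $S_{R_*}$. Let $U$ be a connected component of $\{z \in \Omega_* : \omega(z) \ne 0\}$. Then $U$ is simply connected. -/

import Mathlib

open MeasureTheory Real Set Metric

lemma aux_phi (X : Type) [TopologicalSpace X] [PathConnectedSpace X] :
    ∃ (G : Type) (_ : Group G) (Φ : ∀ {u v : X}, Path.Homotopic.Quotient u v → G),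
      (∀ {u v w : X} (c : Path.Homotopic.Quotient u v) (d : Path.Homotopic.Quotient v w),
        Φ (c.trans d) = Φ c * Φ d) ∧
      (∀ {u : X} (c : Path.Homotopic.Quotient u u), Φ c = 1 → c = Path.Homotopic.Quotient.refl u) := by
  obtain ⟨x0⟩ := (inferInstance : Nonempty X)
  let p : ∀ u : X, Path.Homotopic.Quotient x0 u := fun u => .mk (PathConnectedSpace.somePath x0 u)
  let Φ : ∀ {u v : X}, Path.Homotopic.Quotient u v → FundamentalGroup X x0 :=
    fun {u v} c => (show FundamentalGroup X x0 from ((p u).trans (c.trans (p v).symm)))⁻¹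
  refine ⟨FundamentalGroup X x0, inferInstance, Φ, ?_, ?_⟩
  · intro u v w c d
    simp only [Φ]
    rw [← mul_inv_rev]
    congr 1
    rw [FundamentalGroup.mul_def]
    simp only [Path.Homotopic.Quotient.trans_assoc]
    congr 2
    rw [← Path.Homotopic.Quotient.trans_assoc (p v).symm, Path.Homotopic.Quotient.symm_trans,
      Path.Homotopic.Quotient.refl_trans]
  · intro u c h
    replace h := inv_eq_one.1 h
    rw [FundamentalGroup.one_def] at h
    change (p u).trans (c.trans (p u).symm) = _ at h
    have h2 : ((p u).symm.trans ((p u).trans (c.trans (p u).symm))).trans (p u)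
        = ((p u).symm.trans (.refl x0)).trans (p u) := by
      rw [h]
    simp only [Path.Homotopic.Quotient.trans_assoc] at h2
    rw [← Path.Homotopic.Quotient.trans_assoc (p u).symm] at h2
    simpa using h2

lemma aux_convex {U C : Set ℂ} (hC : Convex ℝ C) (hCU : C ⊆ U) {u v : U} (p q : Path u v)
    (hp : ∀ t, (p t : ℂ) ∈ C) (hq : ∀ t, (q t : ℂ) ∈ C) : p.Homotopic q := by
  have hu : (u : ℂ) ∈ C := by simpa using hp 0
  have hv : (v : ℂ) ∈ C := by simpa using hp 1
  have : ContractibleSpace C := hC.contractibleSpace ⟨_, hu⟩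
  let p' : Path (⟨u, hu⟩ : C) ⟨v, hv⟩ :=
    { toFun := fun t => ⟨p t, hp t⟩, source' := by simp, target' := by simp }
  let q' : Path (⟨u, hu⟩ : C) ⟨v, hv⟩ :=
    { toFun := fun t => ⟨q t, hq t⟩, source' := by simp, target' := by simp }
  have h := (SimplyConnectedSpace.paths_homotopic p' q').map ⟨Set.inclusion hCU, continuous_inclusion hCU⟩
  exact h

open unitInterval in
lemma aux_transport (U : Set ℂ) (hUo : IsOpen U) [PathConnectedSpace U] :
    ∃ (G : Type) (_ : Group G) (e : ℂ → ℂ → G),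
      (∀ C : Set ℂ, Convex ℝ C → C ⊆ U → ∀ u ∈ C, ∀ v ∈ C, ∀ w ∈ C, e u v * e v w = e u w) ∧
      (∀ (x : U) (γ : Path x x) (ψ : ℂ → G) (r : ℝ), 0 < r →
        (∀ s t : I, dist (γ s : ℂ) (γ t) < r → e (γ s) (γ t) = (ψ (γ s))⁻¹ * ψ (γ t)) →
        γ.Homotopic (Path.refl x)) := by
  classical
  obtain ⟨G, iG, Φ, h1, h2⟩ := aux_phi U
  -- segments
  have seg : ∀ u v : ℂ, segment ℝ u v ⊆ U → ∃ (hu : u ∈ U) (hv : v ∈ U)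
      (p : Path (⟨u, hu⟩ : U) ⟨v, hv⟩), ∀ t, (p t : ℂ) ∈ segment ℝ u v := by
    intro u v h
    refine ⟨h (left_mem_segment ℝ u v), h (right_mem_segment ℝ u v), ?_⟩
    have hm : ∀ t : I, AffineMap.lineMap u v (t : ℝ) ∈ segment ℝ u v := by
      intro t
      rw [segment_eq_image_lineMap]
      exact ⟨t, t.2, rfl⟩
    exact ⟨{ toFun := fun t => ⟨AffineMap.lineMap u v (t : ℝ), h (hm t)⟩
             continuous_toFun := by
              apply Continuous.subtype_mk
              exact (AffineMap.lineMap_continuous).comp continuous_subtype_val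
             source' := by simp
             target' := by simp }, hm⟩
  choose hu hv sp hsp using seg
  let e : ℂ → ℂ → G := fun u v => if h : segment ℝ u v ⊆ U then Φ (.mk (sp u v h)) else 1
  -- key
  have key : ∀ C : Set ℂ, Convex ℝ C → C ⊆ U → ∀ (u v : U) (p : Path u v), (∀ t, (p t : ℂ) ∈ C) →
      Φ (.mk p) = e u v := by
    intro C hC hCU u v p hp
    have huC : (u : ℂ) ∈ C := by simpa using hp 0
    have hvC : (v : ℂ) ∈ C := by simpa using hp 1
    have hs : segment ℝ (u : ℂ) v ⊆ C := hC.segment_subset huC hvC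
    have : e u v = Φ (.mk (sp u v (hs.trans hCU))) := by
      simp only [e]; rw [dif_pos]
    rw [this]
    congr 1
    rw [Path.Homotopic.Quotient.eq]
    exact aux_convex hC hCU p _ hp (fun t => hs (hsp _ _ _ t))
  refine ⟨G, iG, e, ?_, ?_⟩
  · intro C hC hCU u hu' v hv' w hw'
    have huv := hC.segment_subset hu' hv'
    have hvw := hC.segment_subset hv' hw'
    have a1 := key C hC hCU _ _ (sp u v (huv.trans hCU)) (fun t => huv (hsp _ _ _ t))
    have a2 := key C hC hCU _ _ (sp v w (hvw.trans hCU)) (fun t => hvw (hsp _ _ _ t))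
    have a3 := key C hC hCU _ _ ((sp u v (huv.trans hCU)).trans (sp v w (hvw.trans hCU))) (by
      intro t
      have : ((sp u v (huv.trans hCU)).trans (sp v w (hvw.trans hCU))) t ∈
        Set.range ((sp u v (huv.trans hCU)).trans (sp v w (hvw.trans hCU))) := ⟨t, rfl⟩
      rw [Path.trans_range] at this
      rcases this with ⟨s, hs⟩ | ⟨s, hs⟩
      · rw [← hs]; exact huv (hsp _ _ _ s)
      · rw [← hs]; exact hvw (hsp _ _ _ s))
    rw [Path.Homotopic.Quotient.mk_trans, h1] at a3
    simp only at a1 a2 a3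
    rw [← a1, ← a2, a3]
  · intro x γ ψ r hr hψ
    let θ : I → G := fun t => Φ (.mk (γ.subpath 0 t)) * (ψ (γ t))⁻¹
    have hloc : IsLocallyConstant θ := by
      rw [IsLocallyConstant.iff_eventually_eq]
      intro t
      obtain ⟨ρ, hρ, hρU⟩ := Metric.isOpen_iff.1 hUo (γ t) (γ t).2
      have hc : Continuous fun s : I => (γ s : ℂ) := continuous_subtype_val.comp γ.continuous
      obtain ⟨η, hη, hηb⟩ := Metric.continuous_iff.1 hc t (min ρ r) (lt_min hρ hr)
      filter_upwards [Metric.ball_mem_nhds t hη] with s hs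
      have hsub : ∀ a, ((γ.subpath t s) a : ℂ) ∈ ball (γ t : ℂ) ρ := by
        intro a
        have : (γ.subpath t s) a ∈ Set.range (γ.subpath t s) := ⟨a, rfl⟩
        rw [Path.range_subpath] at this
        obtain ⟨b, hb, hb'⟩ := this
        rw [← hb']
        refine lt_of_lt_of_le (hηb b ?_) (min_le_left _ _)
        have hs' : dist s t < η := hs
        rw [Subtype.dist_eq, Real.dist_eq] at hs' ⊢
        rw [Set.mem_uIcc] at hb
        rw [abs_lt] at *
        rcases hb with ⟨q1, q2⟩ | ⟨q1, q2⟩ <;>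
        · have q1' : (_ : ℝ) ≤ _ := q1
          have q2' : (_ : ℝ) ≤ _ := q2
          constructor <;> linarith
      have k1 := key _ (convex_ball _ _) hρU _ _ _ hsub
      have k2 := hψ t s (by
        rw [dist_comm]; exact lt_of_lt_of_le (hηb s hs) (min_le_right _ _))
      have k3 : Φ (.mk (γ.subpath 0 s)) = Φ (.mk (γ.subpath 0 t)) * Φ (.mk (γ.subpath t s)) := by
        rw [← h1, ← Path.Homotopic.Quotient.mk_trans]
        congr 1
        rw [Path.Homotopic.Quotient.eq]
        exact Path.Homotopic.symm ⟨Path.Homotopy.subpathTransSubpath γ 0 t s⟩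
      simp only [θ]
      rw [k3, k1, k2]
      group
    have h01 : θ 1 = θ 0 := hloc.apply_eq_of_isPreconnected isPreconnected_univ (mem_univ _) (mem_univ _)
    simp only [θ, Path.subpath_self, Path.source, Path.target] at h01
    have h3 := mul_right_cancel h01
    have hone : ∀ y : U, Φ (.mk (Path.refl y)) = 1 := by
      intro y
      have := h1 (Path.Homotopic.Quotient.refl y) (Path.Homotopic.Quotient.refl y)
      rw [Path.Homotopic.Quotient.trans_refl] at this
      exact left_eq_mul.1 this
    rw [hone, Path.subpath_zero_one] at h3
    have hcast : ∀ (a b : U) (ha : a = x) (hb : b = x), 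
        Φ (.mk (γ.cast ha hb)) = Φ (.mk γ) := by
      intro a b ha hb
      subst ha; subst hb; rfl
    rw [hcast] at h3
    have := h2 _ h3
    rwa [← Path.Homotopic.Quotient.mk_refl, Path.Homotopic.Quotient.eq] at this

/-- Flatness of the unit square with lower left corner `q`. -/
def Flat {G : Type} [Group G] (H V : ℤ → ℤ → G) (q : ℤ × ℤ) : Prop :=
  H q.1 q.2 * V (q.1 + 1) q.2 = V q.1 q.2 * H q.1 (q.2 + 1)

/-- Edge-adjacent far squares. -/
def FarStep (Far : Set (ℤ × ℤ)) (q q' : ℤ × ℤ) : Prop :=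
  q ∈ Far ∧ q' ∈ Far ∧ (q' = (q.1 + 1, q.2) ∨ q' = (q.1 - 1, q.2) ∨ q' = (q.1, q.2 + 1) ∨
    q' = (q.1, q.2 - 1))

lemma aux_one_step {G : Type} [Group G] (Far : Set (ℤ × ℤ)) (q q' : ℤ × ℤ)
    (hs : FarStep Far q q') (H V : ℤ → ℤ → G) :
    ∃ H' V' : ℤ → ℤ → G,
      (∀ a, a ∉ Far → H' a.1 a.2 = H a.1 a.2 ∧ V' a.1 a.2 = V a.1 a.2) ∧
      Flat H' V' q ∧ (∀ a, a ≠ q' → Flat H V a → Flat H' V' a) := by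
  classical
  obtain ⟨m, n⟩ := q
  obtain ⟨hq, hq', h | h | h | h⟩ := hs <;> subst h
  · refine ⟨H, fun a b => if a = m + 1 ∧ b = n then (H m n)⁻¹ * (V m n * H m (n + 1)) else V a b,
      ?_, ?_, ?_⟩
    · rintro ⟨a, b⟩ ha
      grind
    · simp [Flat]
    · rintro ⟨a, b⟩ ha hf
      by_cases hab : a = m ∧ b = n
      · obtain ⟨rfl, rfl⟩ := hab; simp [Flat]
      · simp only [Flat] at *
        grind
  · refine ⟨H, fun a b => if a = m ∧ b = n then H m n * V (m + 1) n * (H m (n + 1))⁻¹ else V a b,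
      ?_, ?_, ?_⟩
    · rintro ⟨a, b⟩ ha
      grind
    · simp [Flat]
    · rintro ⟨a, b⟩ ha hf
      by_cases hab : a = m ∧ b = n
      · obtain ⟨rfl, rfl⟩ := hab; simp [Flat]
      · simp only [Flat] at *
        grind
  · refine ⟨fun a b => if a = m ∧ b = n + 1 then (V m n)⁻¹ * (H m n * V (m + 1) n) else H a b, V,
      ?_, ?_, ?_⟩
    · rintro ⟨a, b⟩ ha
      grind
    · simp [Flat]
    · rintro ⟨a, b⟩ ha hf
      by_cases hab : a = m ∧ b = n
      · obtain ⟨rfl, rfl⟩ := hab; simp [Flat]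
      · simp only [Flat] at *
        grind
  · refine ⟨fun a b => if a = m ∧ b = n then V m n * H m (n + 1) * (V (m + 1) n)⁻¹ else H a b, V,
      ?_, ?_, ?_⟩
    · rintro ⟨a, b⟩ ha
      grind
    · simp [Flat]
    · rintro ⟨a, b⟩ ha hf
      by_cases hab : a = m ∧ b = n
      · obtain ⟨rfl, rfl⟩ := hab; simp [Flat]
      · simp only [Flat] at *
        grind

lemma aux_chain {G : Type} [Group G] (Far Out : Set (ℤ × ℤ)) (q q' : ℤ × ℤ)
    (hs : Relation.ReflTransGen (FarStep Far) q q') (hout : q' ∈ Out) :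
    ∀ (H V : ℤ → ℤ → G),
    ∃ H' V' : ℤ → ℤ → G,
      (∀ a, a ∉ Far → H' a.1 a.2 = H a.1 a.2 ∧ V' a.1 a.2 = V a.1 a.2) ∧
      (q ∈ Out ∨ Flat H' V' q) ∧ (∀ a, a ∉ Out → Flat H V a → Flat H' V' a) := by
  induction hs using Relation.ReflTransGen.head_induction_on with
  | refl => intro H V; exact ⟨H, V, fun _ _ => ⟨rfl, rfl⟩, Or.inl hout, fun _ _ h => h⟩
  | head h1 _ ih =>
    rename_i a c _
    intro H V
    obtain ⟨H1, V1, p1, p2, p3⟩ := aux_one_step Far a c h1 H V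
    obtain ⟨H2, V2, r1, r2, r3⟩ := ih H1 V1
    refine ⟨H2, V2, fun b hb => ⟨(r1 b hb).1.trans (p1 b hb).1, (r1 b hb).2.trans (p1 b hb).2⟩,
      ?_, ?_⟩
    · by_cases ha : a ∈ Out
      · exact Or.inl ha
      · exact Or.inr (r3 a ha p2)
    · intro b hb hf
      by_cases hbc : b = c
      · subst hbc; exact r2.resolve_left hb
      · exact r3 b hb (p3 b hbc hf)

lemma aux_fix {G : Type} [Group G] (Far Out : Set (ℤ × ℤ)) (S : Finset (ℤ × ℤ))
    (hS : ∀ q ∈ S, ∃ q' ∈ Out, Relation.ReflTransGen (FarStep Far) q q') (H V : ℤ → ℤ → G) :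
    ∃ H' V' : ℤ → ℤ → G,
      (∀ a, a ∉ Far → H' a.1 a.2 = H a.1 a.2 ∧ V' a.1 a.2 = V a.1 a.2) ∧
      (∀ q ∈ S, q ∈ Out ∨ Flat H' V' q) ∧ (∀ a, a ∉ Out → Flat H V a → Flat H' V' a) := by
  classical
  induction S using Finset.induction_on with
  | empty => exact ⟨H, V, fun _ _ => ⟨rfl, rfl⟩, by simp, fun _ _ h => h⟩
  | insert q S hq ih =>
    obtain ⟨H1, V1, p1, p2, p3⟩ := ih (fun a ha => hS a (Finset.mem_insert_of_mem ha))
    obtain ⟨q', hq', hc⟩ := hS q (Finset.mem_insert_self _ _)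
    obtain ⟨H2, V2, r1, r2, r3⟩ := aux_chain Far Out q q' hc hq' H1 V1
    refine ⟨H2, V2, fun b hb => ⟨(r1 b hb).1.trans (p1 b hb).1, (r1 b hb).2.trans (p1 b hb).2⟩,
      ?_, fun b hb hf => r3 b hb (p3 b hb hf)⟩
    intro b hb
    by_cases hbo : b ∈ Out
    · exact Or.inl hbo
    · rcases Finset.mem_insert.1 hb with rfl | hb
      · exact r2
      · exact Or.inr (r3 b hbo ((p2 b hb).resolve_left hbo))

lemma aux_int_rec {G : Type} [Group G] (x : G) (f : ℤ → G) :
    ∃ a : ℤ → G, a 0 = x ∧ ∀ m, a (m + 1) = a m * f m := by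
  let b : ℕ → G := fun n => Nat.rec x (fun k y => y * f k) n
  let c : ℕ → G := fun n => Nat.rec x (fun k y => y * (f (-(k : ℤ) - 1))⁻¹) n
  refine ⟨fun m => if 0 ≤ m then b m.toNat else c (-m).toNat, by simp [b], ?_⟩
  intro m
  rcases lt_trichotomy m (-1) with h | h | h
  · obtain ⟨k, rfl⟩ : ∃ k : ℕ, m = -(k : ℤ) - 2 := ⟨(-m - 2).toNat, by omega⟩
    have e1 : (-(-(k : ℤ) - 2 + 1)).toNat = k + 1 := by omega
    have e2 : (-(-(k : ℤ) - 2)).toNat = k + 1 + 1 := by omega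
    have e3 : ¬ (0 ≤ -(k : ℤ) - 2 + 1) := by omega
    have e4 : ¬ (0 ≤ -(k : ℤ) - 2) := by omega
    have e5 : c (k + 1 + 1) = c (k + 1) * (f (-((k + 1 : ℕ) : ℤ) - 1))⁻¹ := rfl
    have e6 : (-((k + 1 : ℕ) : ℤ) - 1) = -(k : ℤ) - 2 := by push_cast; ring
    simp only [e1, e2, e3, e4, if_false, e5, e6]
    group
  · subst h
    simp [b, c]
  · obtain ⟨k, rfl⟩ : ∃ k : ℕ, m = k := ⟨m.toNat, by omega⟩
    have e1 : ((k : ℤ) + 1).toNat = k + 1 := by omega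
    have e3 : (0 ≤ (k : ℤ) + 1) := by omega
    simp [e1, e3, b]

lemma aux_potential {G : Type} [Group G] (N : ℤ) (H V : ℤ → ℤ → G)
    (hflat : ∀ m n : ℤ, |m| ≤ N → |n| ≤ N → Flat H V (m, n)) :
    ∃ g : ℤ → ℤ → G, ∀ m n : ℤ, |m| ≤ N → |n| ≤ N →
      g (m + 1) n = g m n * H m n ∧ g m (n + 1) = g m n * V m n := by
  obtain ⟨a, ha0, ha⟩ := aux_int_rec 1 (fun m => H m 0)
  choose c hc0 hc using fun m => aux_int_rec (a m) (fun n => V m n)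
  refine ⟨c, fun m n hm hn => ⟨?_, hc m n⟩⟩
  have hb : c (m + 1) 0 = c m 0 * H m 0 := by rw [hc0, hc0, ha]
  simp only [Flat] at hflat
  rcases le_total 0 n with h | h
  · induction n, h using Int.leInduction with
    | base => exact hb
    | succ n h ih =>
      have hn' : |n| ≤ N := by rw [abs_le] at *; omega
      have := hflat m n hm hn'
      rw [hc, ih hn', hc, mul_assoc, this, mul_assoc]
  · induction n, h using Int.leInductionDown with
    | base => exact hb
    | pred n h ih =>
      have hn' : |n| ≤ N := by rw [abs_le] at *; omega
      have := hflat m (n - 1) hm hn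
      have q1 := hc m (n - 1)
      have q2 := hc (m + 1) (n - 1)
      have q3 := ih hn'
      rw [sub_add_cancel] at this q1 q2
      rw [q1, q2, mul_assoc, ← this, ← mul_assoc] at q3
      exact mul_right_cancel q3

open Topology in
lemma aux_star (f : ℂ → ℝ) (R : ℝ) (hR : 0 < R) (hf0 : ∀ x, 0 ≤ f x)
    (hcont : ContinuousOn f {z : ℂ | R ≤ ‖z‖})
    (hdecay : ∀ ε > (0:ℝ), ∃ R : ℝ, ∀ z : ℂ, R ≤ ‖z‖ → f z < ε)
    (hlevel : ∀ z : ℂ, R ≤ ‖z‖ → f z ≠ 0 →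
      ∃ C : Set ℂ, IsPreconnected C ∧ z ∈ C ∧ (∀ x ∈ C, R ≤ ‖x‖ ∧ f x = f z) ∧
        (C ∩ Metric.sphere (0:ℂ) R).Nonempty)
    (z : ℂ) (A : Set ℂ) (hA : IsCompact A)
    (hfr : frontier A ⊆ connectedComponentIn {x : ℂ | R < ‖x‖ ∧ f x ≠ 0} z) :
    A ⊆ connectedComponentIn {x : ℂ | R < ‖x‖ ∧ f x ≠ 0} z := by
  set W : Set ℂ := {x : ℂ | R < ‖x‖ ∧ f x ≠ 0} with hW
  set U := connectedComponentIn W z with hU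
  have hUW : U ⊆ W := connectedComponentIn_subset _ _
  have hat : ∀ x : ℂ, R < ‖x‖ → ContinuousAt f x := by
    intro x hx
    apply hcont.continuousAt
    filter_upwards [(isOpen_lt continuous_const continuous_norm).mem_nhds hx] with y hy
    exact le_of_lt hy
  have hWo : IsOpen W := by
    rw [isOpen_iff_mem_nhds]
    rintro x ⟨hx1, hx2⟩
    filter_upwards [(isOpen_lt continuous_const continuous_norm).mem_nhds hx1,
      (hat x hx1).eventually_ne hx2] with y h1 h2 using ⟨h1, h2⟩
  have hUo : IsOpen U := hWo.connectedComponentIn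
  have hcl : IsClosed A := hA.isClosed
  have hfrA : frontier A ⊆ A := hcl.frontier_subset
  obtain ⟨δ, hδ, hδf⟩ : ∃ δ, 0 < δ ∧ ∀ x ∈ frontier A, δ ≤ f x := by
    apply IsCompact.exists_forall_le' (hA.of_isClosed_subset isClosed_frontier hfrA)
    · intro x hx
      exact (hat x (hUW (hfr hx)).1).continuousWithinAt
    · intro x hx
      exact lt_of_le_of_ne (hf0 x) (Ne.symm (hUW (hfr hx)).2)
  -- connected sets missing the frontier
  have hcross : ∀ C : Set ℂ, IsPreconnected C → (∀ x ∈ C, x ∉ frontier A) →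
      ∀ x ∈ C, ∀ y ∈ C, x ∈ A → y ∈ A := by
    intro C hC hCf x hx y hy hxA
    by_contra hyA
    have hint : ∀ w ∈ C, w ∈ A → w ∈ interior A := by
      intro w hw hwA
      by_contra hwi
      exact hCf w hw ⟨subset_closure hwA, hwi⟩
    obtain ⟨w, hw1, hw2, hw3⟩ := hC (interior A) Aᶜ isOpen_interior hcl.isOpen_compl
      (fun w hw => (em (w ∈ A)).imp (hint w hw) id) ⟨x, hx, hint x hx hxA⟩ ⟨y, hy, hyA⟩
    exact hw3 (interior_subset hw2)
  have hD : ∀ x y : ℂ, ‖x‖ ≤ R → ‖y‖ ≤ R → x ∈ A → y ∈ A := by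
    intro x y hx hy
    refine hcross (closedBall 0 R) (convex_closedBall _ _).isPreconnected ?_ x (by simpa using hx)
      y (by simpa using hy)
    intro w hw hw2
    have := (hUW (hfr hw2)).1
    have hw' : ‖w‖ ≤ R := by simpa using hw
    linarith
  have hP : ∀ p : ℂ, R ≤ ‖p‖ → 0 < f p → f p < δ → (p ∈ A ↔ (0 : ℂ) ∈ A) := by
    intro p hp h0 h1
    obtain ⟨C, hC, hpC, hCl, s, hsC, hs⟩ := hlevel p hp h0.ne'
    have hs' : ‖s‖ ≤ R := by simpa using hs.le
    have hCf : ∀ x ∈ C, x ∉ frontier A := by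
      intro x hx hxf
      have := hδf x hxf
      rw [(hCl x hx).2] at this
      linarith
    constructor
    · intro h
      exact hD s 0 hs' (by simpa using hR.le) (hcross C hC hCf p hpC s hsC h)
    · intro h
      exact hcross C hC hCf s hsC p hpC (hD 0 s (by simpa using hR.le) hs' h)
  have hnoclopen : ∀ Q : Set ℂ, IsOpen Q → IsCompact Q → Q.Nonempty → False := by
    intro Q h1 h2 h3
    have : Q = univ := IsClopen.eq_univ ⟨h2.isClosed, h1⟩ h3
    rw [this] at h2
    exact NoncompactSpace.noncompact_univ h2
  intro a haA
  by_contra haU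
  by_cases h0 : (0 : ℂ) ∈ A
  · -- the set `A ∪ {f ≥ δ}` is clopen and bounded
    refine hnoclopen (A ∪ {x | x ∈ {z : ℂ | R ≤ ‖z‖} ∧ f x ∈ Ici δ}) ?_ ?_ ⟨a, Or.inl haA⟩
    · have key : ∀ x, R < ‖x‖ → δ ≤ f x →
          (A ∪ {x | x ∈ {z : ℂ | R ≤ ‖z‖} ∧ f x ∈ Ici δ}) ∈ 𝓝 x := by
        intro x hx hfx
        filter_upwards [(isOpen_lt continuous_const continuous_norm).mem_nhds hx,
          (hat x hx).eventually (lt_mem_nhds (lt_of_lt_of_le hδ hfx))] with y hy1 hy2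
        by_cases hyA : y ∈ A
        · exact Or.inl hyA
        · refine Or.inr ⟨le_of_lt hy1, ?_⟩
          by_contra hlt
          exact hyA ((hP y (le_of_lt hy1) hy2 (not_le.1 hlt)).2 h0)
      rw [isOpen_iff_mem_nhds]
      intro x hx
      by_cases hxA : x ∈ A
      · by_cases hxi : x ∈ interior A
        · exact Filter.mem_of_superset (mem_interior_iff_mem_nhds.1 hxi) subset_union_left
        · have hxf : x ∈ frontier A := ⟨subset_closure hxA, hxi⟩
          exact key x (hUW (hfr hxf)).1 (hδf x hxf)
      · have hx' := hx.resolve_left hxA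
        refine key x ?_ hx'.2
        by_contra hle
        exact hxA (hD 0 x (by simpa using hR.le) (not_lt.1 hle) h0)
    · apply hA.union
      apply isCompact_of_isClosed_isBounded
      · exact hcont.preimage_isClosed_of_isClosed (isClosed_le continuous_const continuous_norm)
          isClosed_Ici
      · obtain ⟨M, hM⟩ := hdecay δ hδ
        refine (isBounded_closedBall (x := (0 : ℂ)) (r := M)).subset ?_
        intro x hx
        by_contra hxM
        have : M ≤ ‖x‖ := by
          simp at hxM; exact hxM.le
        have h2 := hM x this
        have h3 : δ ≤ f x := hx.2
        linarith
  · -- the set `A \ U` is clopen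
    refine hnoclopen (A \ U) ?_ (hA.diff hUo) ⟨a, haA, haU⟩
    rw [isOpen_iff_mem_nhds]
    rintro b ⟨hbA, hbU⟩
    have hbi : A ∈ 𝓝 b := by
      rw [← mem_interior_iff_mem_nhds]
      by_contra hbi
      exact hbU (hfr ⟨subset_closure hbA, hbi⟩)
    have hbR : R < ‖b‖ := by
      by_contra hle
      exact h0 (hD b 0 (not_lt.1 hle) (by simpa using hR.le) hbA)
    by_cases hfb : f b = 0
    · filter_upwards [hbi, (isOpen_lt continuous_const continuous_norm).mem_nhds hbR,
        (hat b hbR).eventually (gt_mem_nhds (show f b < δ by rw [hfb]; exact hδ))] with y h1 h2 h3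
      refine ⟨h1, fun hyU => ?_⟩
      have hne := (hUW hyU).2
      exact h0 ((hP y (le_of_lt h2) (lt_of_le_of_ne (hf0 y) (Ne.symm hne)) h3).1 h1)
    · have hbW : b ∈ W := ⟨hbR, hfb⟩
      filter_upwards [hbi, (hWo.connectedComponentIn (x := b)).mem_nhds
        (mem_connectedComponentIn hbW)] with y h1 h2
      refine ⟨h1, fun hyU => hbU ?_⟩
      have e1 := connectedComponentIn_eq h2
      have e2 := connectedComponentIn_eq hyU
      rw [hU, e2, ← e1]
      exact mem_connectedComponentIn hbW

open Topology unitInterval in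
lemma aux_topo (U : Set ℂ) (hUo : IsOpen U) (hUc : IsPathConnected U)
    (star : ∀ A : Set ℂ, IsCompact A → frontier A ⊆ U → A ⊆ U) : SimplyConnectedSpace U := by
  classical
  have : PathConnectedSpace U := isPathConnected_iff_pathConnectedSpace.1 hUc
  rw [simply_connected_iff_loops_nullhomotopic]
  refine ⟨this, ?_⟩
  obtain ⟨G, iG, e, E1, E2⟩ := aux_transport U hUo
  intro x0 γ
  have hγc : Continuous fun t : I => (γ t : ℂ) := continuous_subtype_val.comp γ.continuous
  set K : Set ℂ := range fun t : I => (γ t : ℂ) with hK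
  have hKc : IsCompact K := isCompact_range hγc
  have hKU : K ⊆ U := by rintro _ ⟨t, rfl⟩; exact (γ t).2
  obtain ⟨d, hd, hdU⟩ := hKc.exists_cthickening_subset_open hUo hKU
  obtain ⟨M, hM⟩ := hKc.isBounded.exists_norm_le
  set ε : ℝ := d / 10 with hε
  have hε0 : 0 < ε := by positivity
  -- boxes
  let B : ℂ → Set ℂ := fun x => {w | (x.re - 4 * ε ≤ w.re ∧ w.re ≤ x.re + 4 * ε) ∧
    (x.im - 4 * ε ≤ w.im ∧ w.im ≤ x.im + 4 * ε)}
  have hrect : ∀ a b c d : ℝ, Convex ℝ {w : ℂ | (a ≤ w.re ∧ w.re ≤ b) ∧ (c ≤ w.im ∧ w.im ≤ d)} := by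
    intro a b c d
    exact ((convex_halfSpace_re_ge a).inter (convex_halfSpace_re_le b)).inter
      ((convex_halfSpace_im_ge c).inter (convex_halfSpace_im_le d))
  have hBc : ∀ x, Convex ℝ (B x) := fun x => hrect _ _ _ _
  have hBU : ∀ x ∈ K, B x ⊆ U := by
    intro x hx w hw
    apply hdU
    apply mem_cthickening_of_dist_le w x d K hx
    rw [Complex.dist_eq]
    refine (Complex.norm_le_abs_re_add_abs_im _).trans ?_
    obtain ⟨⟨h1, h2⟩, h3, h4⟩ := hw
    have a1 : |(w - x).re| ≤ 4 * ε := by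
      rw [abs_le, Complex.sub_re]; constructor <;> linarith
    have a2 : |(w - x).im| ≤ 4 * ε := by
      rw [abs_le, Complex.sub_im]; constructor <;> linarith
    linarith
  let pt : ℤ → ℤ → ℂ := fun m n => ⟨ε * m, ε * n⟩
  let Sq : ℤ × ℤ → Set ℂ := fun q => {w | (ε * q.1 ≤ w.re ∧ w.re ≤ ε * q.1 + ε) ∧
    (ε * q.2 ≤ w.im ∧ w.im ≤ ε * q.2 + ε)}
  have hSqc : ∀ q, Convex ℝ (Sq q) := fun q => hrect _ _ _ _
  have hSqK : ∀ q, IsCompact (Sq q) := by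
    intro q
    have : Sq q = Icc (ε * q.1) (ε * q.1 + ε) ×ℂ Icc (ε * q.2) (ε * q.2 + ε) := by
      ext w; simp [Sq, Complex.mem_reProdIm]
    rw [this]
    exact isCompact_Icc.reProdIm isCompact_Icc
  let nearTo : ℂ → ℤ × ℤ → Prop := fun x q =>
    (x.re - 3 * ε ≤ ε * q.1 ∧ ε * q.1 ≤ x.re + 3 * ε) ∧
    (x.im - 3 * ε ≤ ε * q.2 ∧ ε * q.2 ≤ x.im + 3 * ε)
  let Far : Set (ℤ × ℤ) := {q | ¬ ∃ x ∈ K, nearTo x q}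
  have hnearSq : ∀ x q, nearTo x q → Sq q ⊆ B x := by
    rintro x q ⟨⟨h1, h2⟩, h3, h4⟩ w ⟨⟨g1, g2⟩, g3, g4⟩
    refine ⟨⟨?_, ?_⟩, ?_, ?_⟩ <;> linarith
  have hnearU : ∀ q, q ∉ Far → Sq q ⊆ U := by
    intro q hq
    simp only [Far, mem_ofPred_eq, not_not] at hq
    obtain ⟨x, hx, hn⟩ := hq
    exact (hnearSq x q hn).trans (hBU x hx)
  let H : ℤ → ℤ → G := fun m n => e (pt m n) (pt (m + 1) n)
  let V : ℤ → ℤ → G := fun m n => e (pt m n) (pt m (n + 1))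
  have hflatU : ∀ q, Sq q ⊆ U → Flat H V q := by
    rintro ⟨m, n⟩ hq
    have c1 : pt m n ∈ Sq (m, n) := by
      refine ⟨⟨?_, ?_⟩, ?_, ?_⟩ <;> simp only [pt] <;> linarith
    have c2 : pt (m + 1) n ∈ Sq (m, n) := by
      refine ⟨⟨?_, ?_⟩, ?_, ?_⟩ <;> simp only [pt] <;> push_cast <;> linarith
    have c3 : pt m (n + 1) ∈ Sq (m, n) := by
      refine ⟨⟨?_, ?_⟩, ?_, ?_⟩ <;> simp only [pt] <;> push_cast <;> linarith
    have c4 : pt (m + 1) (n + 1) ∈ Sq (m, n) := by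
      refine ⟨⟨?_, ?_⟩, ?_, ?_⟩ <;> simp only [pt] <;> push_cast <;> linarith
    simp only [Flat, H, V]
    rw [E1 _ (hSqc _) hq _ c1 _ c2 _ c4, E1 _ (hSqc _) hq _ c1 _ c3 _ c4]
  -- the big box
  obtain ⟨N, hN⟩ : ∃ N : ℤ, M / ε + 3 ≤ N := ⟨_, Int.le_ceil _⟩
  have hNε : M + 3 * ε ≤ ε * N := by
    have := mul_le_mul_of_nonneg_left hN hε0.le
    have h2 : ε * (M / ε + 3) = M + 3 * ε := by field_simp
    linarith
  have hnearN : ∀ x ∈ K, ∀ q, nearTo x q → |q.1| ≤ N ∧ |q.2| ≤ N := by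
    rintro x hx q ⟨⟨h1, h2⟩, h3, h4⟩
    have hx' := hM x hx
    have r1 := abs_le.1 ((Complex.abs_re_le_norm x).trans hx')
    have r2 := abs_le.1 ((Complex.abs_im_le_norm x).trans hx')
    have gen : ∀ k : ℤ, -(ε * N) ≤ ε * k → ε * k ≤ ε * N → |k| ≤ N := by
      intro k k1 k2
      have k2' : (k : ℝ) ≤ N := le_of_mul_le_mul_left k2 hε0
      have k1' : ((-N : ℤ) : ℝ) ≤ k := by
        push_cast
        apply le_of_mul_le_mul_left _ hε0
        linarith
      rw [abs_le]
      exact ⟨by exact_mod_cast k1', by exact_mod_cast k2'⟩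
    constructor <;> apply gen <;> linarith
  let Out : Set (ℤ × ℤ) := {q | ¬ (|q.1| ≤ N ∧ |q.2| ≤ N)}
  let S0 : Finset (ℤ × ℤ) := Finset.Icc (-N) N ×ˢ Finset.Icc (-N) N
  have hS0 : ∀ q, q ∉ Out → q ∈ S0 := by
    intro q hq
    simp only [Out, mem_ofPred_eq, not_not, abs_le] at hq
    simp only [S0, Finset.mem_product, Finset.mem_Icc]
    exact hq
  -- floors
  have hfl : ∀ s : ℝ, ∃ m : ℤ, ε * m ≤ s ∧ s < ε * m + ε := by
    intro s
    refine ⟨⌊s / ε⌋, ?_, ?_⟩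
    · have := mul_le_mul_of_nonneg_left (Int.floor_le (s / ε)) hε0.le
      rwa [mul_div_cancel₀ _ hε0.ne'] at this
    · have := mul_lt_mul_of_pos_left (Int.lt_floor_add_one (s / ε)) hε0
      rw [mul_div_cancel₀ _ hε0.ne'] at this
      linarith
  have hlt : ∀ a b : ℤ, ε * a < ε * b → a < b := by
    intro a b h
    exact_mod_cast lt_of_mul_lt_mul_left h hε0.le
  have hle : ∀ a b : ℤ, a ≤ b → ε * a ≤ ε * b := by
    intro a b h
    exact mul_le_mul_of_nonneg_left (by exact_mod_cast h) hε0.le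
  have hnb : ∀ s : ℝ, ∀ᶠ y in 𝓝 s, ∀ m : ℤ, ε * m ≤ y → y < ε * m + ε →
      ε * m ≤ s ∧ s ≤ ε * m + ε := by
    intro s
    obtain ⟨m0, h1, h2⟩ := hfl s
    obtain ⟨c0, h3, h4⟩ := hfl (-s)
    filter_upwards [gt_mem_nhds h2, lt_mem_nhds (show - (ε * c0) - ε < s by linarith)]
      with y hy1 hy2 m k1 k2
    constructor
    · have : m < m0 + 1 := hlt _ _ (by push_cast; linarith)
      have := hle m m0 (by omega)
      linarith
    · have : -c0 - 1 < m + 1 := hlt _ _ (by push_cast; linarith)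
      have := hle (-c0) (m + 1) (by omega)
      push_cast at this
      linarith
  -- bad squares can be connected to the outside
  have hreach : ∀ q : ℤ × ℤ, ¬ Sq q ⊆ U →
      ∃ q' ∈ Out, Relation.ReflTransGen (FarStep Far) q q' := by
    intro q hq
    by_contra hno
    push Not at hno
    set T : Set (ℤ × ℤ) := {q' | Relation.ReflTransGen (FarStep Far) q q'} with hT
    have hTfin : T.Finite := by
      refine (Finset.finite_toSet S0).subset ?_
      intro q' hq'
      exact hS0 q' (fun ho => hno q' ho hq')
    set A : Set ℂ := ⋃ q' ∈ T, Sq q' with hA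
    have hAc : IsCompact A := hTfin.isCompact_biUnion (fun q' _ => hSqK q')
    have hqA : Sq q ⊆ A := by
      intro w hw
      exact mem_biUnion (show q ∈ T from Relation.ReflTransGen.refl) hw
    refine hq (hqA.trans (star A hAc ?_))
    intro b hb
    by_contra hbU
    have hbA : b ∈ A := hAc.isClosed.frontier_subset hb
    refine hb.2 (mem_interior_iff_mem_nhds.2 ?_)
    obtain ⟨q1, hq1T, hq1⟩ := mem_iUnion₂.1 hbA
    have hfar : ∀ q2, b ∈ Sq q2 → q2 ∈ Far := by
      intro q2 h2
      by_contra hn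
      exact hbU (hnearU q2 hn h2)
    have hall : ∀ q2, b ∈ Sq q2 → q2 ∈ T := by
      intro q2 hq2
      have hmid : b ∈ Sq (q2.1, q1.2) := ⟨hq2.1, hq1.2⟩
      have hclose : ∀ (s : ℝ) (a c : ℤ), ε * a ≤ s → s ≤ ε * a + ε → ε * c ≤ s → s ≤ ε * c + ε →
          c = a ∨ c = a + 1 ∨ c = a - 1 := by
        intro s a c h1 h2 h3 h4
        have u1 : a < c + 2 := hlt _ _ (by push_cast; linarith)
        have u2 : c < a + 2 := hlt _ _ (by push_cast; linarith)
        omega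
      have s1 : (q2.1, q1.2) ∈ T := by
        rcases hclose b.re q1.1 q2.1 hq1.1.1 hq1.1.2 hq2.1.1 hq2.1.2 with h | h | h
        · rw [h]; exact hq1T
        · exact Relation.ReflTransGen.tail hq1T
            ⟨hfar _ hq1, hfar _ hmid, Or.inl (by rw [h])⟩
        · exact Relation.ReflTransGen.tail hq1T
            ⟨hfar _ hq1, hfar _ hmid, Or.inr (Or.inl (by rw [h]))⟩
      rcases hclose b.im q1.2 q2.2 hq1.2.1 hq1.2.2 hq2.2.1 hq2.2.2 with h | h | h
      · have : q2 = (q2.1, q1.2) := by rw [← h]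
        rw [this]; exact s1
      · exact Relation.ReflTransGen.tail s1
            ⟨hfar _ hmid, hfar _ hq2, Or.inr (Or.inr (Or.inl (by rw [← h])))⟩
      · exact Relation.ReflTransGen.tail s1
            ⟨hfar _ hmid, hfar _ hq2, Or.inr (Or.inr (Or.inr (by rw [← h])))⟩
    filter_upwards [Complex.continuous_re.continuousAt.eventually (hnb b.re),
      Complex.continuous_im.continuousAt.eventually (hnb b.im)] with y hy1 hy2
    obtain ⟨m, m1, m2⟩ := hfl y.re
    obtain ⟨n, n1, n2⟩ := hfl y.im
    refine mem_biUnion (hall (m, n) ⟨hy1 m m1 m2, hy2 n n1 n2⟩) ?_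
    exact ⟨⟨m1, m2.le⟩, n1, n2.le⟩
  obtain ⟨H', V', r1, r2, r3⟩ := aux_fix Far Out (S0.filter fun q => ¬ Sq q ⊆ U)
    (fun q hq => hreach q (Finset.mem_filter.1 hq).2) H V
  obtain ⟨g, hg⟩ := aux_potential N H' V' (by
    intro m n hm hn
    have ho : (m, n) ∉ Out := by simp only [Out, mem_ofPred_eq, not_not]; exact ⟨hm, hn⟩
    by_cases hsub : Sq (m, n) ⊆ U
    · exact r3 _ ho (hflatU _ hsub)
    · exact (r2 (m, n) (Finset.mem_filter.2 ⟨hS0 _ ho, hsub⟩)).resolve_left ho)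
  have hgH : ∀ x ∈ K, ∀ m n, nearTo x (m, n) → g (m + 1) n = g m n * e (pt m n) (pt (m + 1) n) := by
    intro x hx m n hn
    obtain ⟨b1, b2⟩ := hnearN x hx _ hn
    rw [(hg m n b1 b2).1, (r1 (m, n) (by simp only [Far, mem_ofPred_eq, not_not]; exact ⟨x, hx, hn⟩)).1]
  have hgV : ∀ x ∈ K, ∀ m n, nearTo x (m, n) → g m (n + 1) = g m n * e (pt m n) (pt m (n + 1)) := by
    intro x hx m n hn
    obtain ⟨b1, b2⟩ := hnearN x hx _ hn
    rw [(hg m n b1 b2).2, (r1 (m, n) (by simp only [Far, mem_ofPred_eq, not_not]; exact ⟨x, hx, hn⟩)).2]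
  have hptB : ∀ x m n, nearTo x (m, n) → pt m n ∈ B x := by
    rintro x m n ⟨⟨h1, h2⟩, h3, h4⟩
    simp only at h1 h2 h3 h4
    refine ⟨⟨?_, ?_⟩, ?_, ?_⟩ <;> simp only [pt] <;> linarith
  have hee : ∀ x ∈ K, ∀ u ∈ B x, e u u = 1 := by
    intro x hx u hu
    exact mul_eq_left.1 (E1 _ (hBc x) (hBU x hx) u hu u hu u hu)
  have hmoveH : ∀ x ∈ K, ∀ m m' n, nearTo x (m, n) → nearTo x (m', n) →
      (m' = m ∨ m' = m + 1 ∨ m' = m - 1) → g m' n = g m n * e (pt m n) (pt m' n) := by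
    intro x hx m m' n hn hn' h
    rcases h with h | h | h
    · subst h; rw [hee x hx _ (hptB x _ _ hn), mul_one]
    · subst h; exact hgH x hx m n hn
    · obtain rfl : m = m' + 1 := by omega
      rw [hgH x hx m' n hn', mul_assoc, E1 _ (hBc x) (hBU x hx) _ (hptB x _ _ hn') _ (hptB x _ _ hn)
        _ (hptB x _ _ hn'), hee x hx _ (hptB x _ _ hn'), mul_one]
  have hmoveV : ∀ x ∈ K, ∀ m n n', nearTo x (m, n) → nearTo x (m, n') →
      (n' = n ∨ n' = n + 1 ∨ n' = n - 1) → g m n' = g m n * e (pt m n) (pt m n') := by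
    intro x hx m n n' hn hn' h
    rcases h with h | h | h
    · subst h; rw [hee x hx _ (hptB x _ _ hn), mul_one]
    · subst h; exact hgV x hx m n hn
    · obtain rfl : n = n' + 1 := by omega
      rw [hgV x hx m n' hn', mul_assoc, E1 _ (hBc x) (hBU x hx) _ (hptB x _ _ hn') _ (hptB x _ _ hn)
        _ (hptB x _ _ hn'), hee x hx _ (hptB x _ _ hn'), mul_one]
  choose fl hfl1 hfl2 using hfl
  refine E2 x0 γ (fun x => g (fl x.re) (fl x.im) * e (pt (fl x.re) (fl x.im)) x) ε hε0 ?_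
  intro s t hst
  have hx : (γ s : ℂ) ∈ K := ⟨s, rfl⟩
  generalize (γ s : ℂ) = x at *
  generalize (γ t : ℂ) = y at *
  rw [Complex.dist_eq] at hst
  have d1 := abs_lt.1 (lt_of_le_of_lt (Complex.abs_re_le_norm _) hst)
  have d2 := abs_lt.1 (lt_of_le_of_lt (Complex.abs_im_le_norm _) hst)
  rw [Complex.sub_re] at d1
  rw [Complex.sub_im] at d2
  have f1 := hfl1 x.re
  have f2 := hfl2 x.re
  have f3 := hfl1 x.im
  have f4 := hfl2 x.im
  have f5 := hfl1 y.re
  have f6 := hfl2 y.re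
  have f7 := hfl1 y.im
  have f8 := hfl2 y.im
  generalize fl x.re = m at *
  generalize fl x.im = n at *
  generalize fl y.re = m' at *
  generalize fl y.im = n' at *
  have n1 : nearTo x (m, n) := by refine ⟨⟨?_, ?_⟩, ?_, ?_⟩ <;> simp only <;> linarith
  have n2 : nearTo x (m', n) := by refine ⟨⟨?_, ?_⟩, ?_, ?_⟩ <;> simp only <;> linarith
  have n3 : nearTo x (m', n') := by refine ⟨⟨?_, ?_⟩, ?_, ?_⟩ <;> simp only <;> linarith
  have hxB : x ∈ B x := by refine ⟨⟨?_, ?_⟩, ?_, ?_⟩ <;> linarith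
  have hyB : y ∈ B x := by refine ⟨⟨?_, ?_⟩, ?_, ?_⟩ <;> linarith
  have i1 : m' = m ∨ m' = m + 1 ∨ m' = m - 1 := by
    have u1 : m < m' + 2 := hlt _ _ (by push_cast; linarith)
    have u2 : m' < m + 2 := hlt _ _ (by push_cast; linarith)
    omega
  have i2 : n' = n ∨ n' = n + 1 ∨ n' = n - 1 := by
    have u1 : n < n' + 2 := hlt _ _ (by push_cast; linarith)
    have u2 : n' < n + 2 := hlt _ _ (by push_cast; linarith)
    omega
  have EB := E1 _ (hBc x) (hBU x hx)
  have p1 := hptB x _ _ n1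
  have p2 := hptB x _ _ n2
  have p3 := hptB x _ _ n3
  rw [hmoveV x hx m' n n' n2 n3 i2, hmoveH x hx m m' n n1 n2 i1, mul_assoc (g m n),
    EB _ p1 _ p2 _ p3, mul_assoc (g m n), EB _ p1 _ p3 _ hyB, mul_inv_rev, mul_assoc,
    inv_mul_cancel_left, eq_inv_mul_iff_mul_eq]
  exact EB _ p1 _ hxB _ hyB

/-- Lemma 3.5 (ii): under the strong maximum principle, decay at infinity, and the
assumption that every nonzero level-set component meets the inner circle, each
connected component `U` of `{z : |z| > R*, ω(z) ≠ 0}` is simply connected. -/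
theorem component_simply_connected (ω : ℂ → ℝ) (Rstar : ℝ) (hR : 0 < Rstar)
    (hsmooth : ContDiffOn ℝ (⊤ : ℕ∞) ω {z : ℂ | Rstar < ‖z‖})
    (hcont : ContinuousOn ω {z : ℂ | Rstar ≤ ‖z‖})
    (hdecay : ∀ ε > (0:ℝ), ∃ R : ℝ, ∀ z : ℂ, R ≤ ‖z‖ → |ω z| < ε)
    (hlevel : ∀ z : ℂ, Rstar ≤ ‖z‖ → ω z ≠ 0 →
      (connectedComponentIn {x : ℂ | Rstar ≤ ‖x‖ ∧ ω x = ω z} z ∩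
        Metric.sphere (0:ℂ) Rstar).Nonempty)
    (hmax : ∀ z : ℂ, Rstar < ‖z‖ → 0 < ω z → ¬ IsMaxOn ω {x : ℂ | Rstar < ‖x‖} z)
    (hmin : ∀ z : ℂ, Rstar < ‖z‖ → ω z < 0 → ¬ IsMinOn ω {x : ℂ | Rstar < ‖x‖} z)
    (U : Set ℂ) (z : ℂ) (hz : Rstar < ‖z‖) (hωz : ω z ≠ 0)
    (hU : U = connectedComponentIn {x : ℂ | Rstar < ‖x‖ ∧ ω x ≠ 0} z) :
    SimplyConnectedSpace U := by
  have hWeq : {x : ℂ | Rstar < ‖x‖ ∧ ω x ≠ 0} = {x : ℂ | Rstar < ‖x‖ ∧ |ω x| ≠ 0} := by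
    ext x; simp
  have hWo : IsOpen {x : ℂ | Rstar < ‖x‖ ∧ ω x ≠ 0} := by
    have ho : IsOpen {x : ℂ | Rstar < ‖x‖} := isOpen_lt continuous_const continuous_norm
    exact (hcont.mono (fun x (hx : Rstar < ‖x‖) => hx.le)).isOpen_inter_preimage ho
      isOpen_compl_singleton
  have hUo : IsOpen U := by rw [hU]; exact hWo.connectedComponentIn
  have hUc : IsConnected U := by
    rw [hU]; exact isConnected_connectedComponentIn_iff.2 ⟨hz, hωz⟩
  refine aux_topo U hUo (hUo.isConnected_iff_isPathConnected.1 hUc) ?_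
  intro A hA hfr
  rw [hU, hWeq] at hfr ⊢
  refine aux_star (fun x => |ω x|) Rstar hR (fun x => abs_nonneg _) hcont.abs hdecay ?_ z A hA hfr
  intro w hw hw0
  refine ⟨connectedComponentIn {x : ℂ | Rstar ≤ ‖x‖ ∧ ω x = ω w} w,
    isPreconnected_connectedComponentIn, mem_connectedComponentIn ⟨hw, rfl⟩, ?_,
    hlevel w hw (by simpa using hw0)⟩
  intro x hx
  have := connectedComponentIn_subset _ _ hx
  exact ⟨this.1, by rw [this.2]⟩
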